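/- arXiv:2408.08233 — 4 statements merged into one kernel-verified Lean document; each statement's English description precedes it below -/
import Mathlib

section
/- Weak-convergence continuity of quadratic transport functionals: Let X and Y be Polish spaces endowed with Borel probability measures μ and ν, and let γ_n, γ ∈ C(μ,ν). Let a : X×X → X̃ and b : Y×Y → Ỹ be Borel measurable maps into separable metric spaces X̃ and Ỹ, and let c : X̃ × Ỹ → [0,∞) be continuous with c(u,v) ≤ f(u) + g(v) for some continuous f : X̃ → ℝ and g : Ỹ → ℝ satisfying ∫ f(a(x,x')) (μ⊗μ)(dx×dx') < ∞ and ∫ g(b(y,y')) (ν⊗ν)(dy×dy') < ∞. If γ_n → γ weakly, then ∫∫_{(X×Y)²} c(a(x,x'), b(y,y')) (γ_n⊗γ_n)(dx×dy)(dx'×dy') → ∫∫_{(X×Y)²} c(a(x,x'), b(y,y')) (γ⊗γ)(dx×dy)(dx'×dy'). -/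
open MeasureTheory

noncomputable section

/-- The set of couplings of two measures. -/
def Couplings {X Y : Type*} [MeasurableSpace X] [MeasurableSpace Y]
    (μ : Measure X) (ν : Measure Y) : Set (Measure (X × Y)) :=
  {π | IsProbabilityMeasure π ∧ π.map Prod.fst = μ ∧ π.map Prod.snd = ν}

open Filter Topology

/-- Along a weakly convergent sequence of probability measures, integrals of a nonnegative continuous
function converge as soon as it is dominated by a continuous function that is integrable with the
same integral against all the measures. -/
theorem tendsto_integral_of_le_of_integral_eq {Ω : Type*} [TopologicalSpace Ω] [MeasurableSpace Ω]
    [OpensMeasurableSpace Ω] [HasOuterApproxClosed Ω]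
    {P : ℕ → ProbabilityMeasure Ω} {Q : ProbabilityMeasure Ω} (hPQ : Tendsto P atTop (𝓝 Q))
    {c h : Ω → ℝ} (hc : Continuous c) (hh : Continuous h) (hc0 : ∀ x, 0 ≤ c x)
    (hch : ∀ x, c x ≤ h x) (hP : ∀ n, Integrable h (P n : Measure Ω))
    (hQ : Integrable h (Q : Measure Ω))
    (heq : ∀ n, ∫ x, h x ∂(P n : Measure Ω) = ∫ x, h x ∂(Q : Measure Ω)) :
    Tendsto (fun n => ∫ x, c x ∂(P n : Measure Ω)) atTop (𝓝 (∫ x, c x ∂(Q : Measure Ω))) := by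
  have lower : ∀ k : Ω → ℝ, Continuous k → (∀ x, 0 ≤ k x) → (∀ x, k x ≤ h x) →
      ∀ r < ∫ x, k x ∂(Q : Measure Ω), ∀ᶠ n in atTop, r < ∫ x, k x ∂(P n : Measure Ω) := by
    intro k hk hk0 hkh r hr
    have int : ∀ R : ProbabilityMeasure Ω, Integrable h (R : Measure Ω) →
        Integrable k (R : Measure Ω) := fun R hR =>
      hR.mono' hk.measurable.aestronglyMeasurable
        (Eventually.of_forall fun x => by rw [Real.norm_of_nonneg (hk0 x)]; exact hkh x)
    have conv : ∀ R : ProbabilityMeasure Ω, Integrable h (R : Measure Ω) →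
        ENNReal.ofReal (∫ x, k x ∂(R : Measure Ω)) = ∫⁻ x, ENNReal.ofReal (k x) ∂(R : Measure Ω) :=
      fun R hR => ofReal_integral_eq_lintegral_ofReal (int R hR) (Eventually.of_forall hk0)
    rcases lt_or_ge r 0 with hr0 | hr0
    · exact Eventually.of_forall fun n => hr0.trans_le (integral_nonneg hk0)
    have fatou := lintegral_le_liminf_lintegral_of_forall_isOpen_measure_le_liminf_measure
      hk hk0 fun G hG => ProbabilityMeasure.le_liminf_measure_open_of_tendsto hPQ hG
    rw [← conv Q hQ] at fatou
    filter_upwards [eventually_lt_of_lt_liminf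
      (((ENNReal.ofReal_lt_ofReal_iff (hr0.trans_lt hr)).2 hr).trans_le fatou)] with n hn
    rw [← conv _ (hP n)] at hn
    exact (ENNReal.ofReal_lt_ofReal_iff_of_nonneg hr0).1 hn
  have sub : ∀ R : ProbabilityMeasure Ω, Integrable h (R : Measure Ω) →
      ∫ x, (h x - c x) ∂(R : Measure Ω) =
        ∫ x, h x ∂(R : Measure Ω) - ∫ x, c x ∂(R : Measure Ω) := fun R hR =>
    integral_sub hR (hR.mono' hc.measurable.aestronglyMeasurable
      (Eventually.of_forall fun x => by rw [Real.norm_of_nonneg (hc0 x)]; exact hch x))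
  refine tendsto_order.2 ⟨fun r hr => lower c hc hc0 hch r hr, fun r hr => ?_⟩
  filter_upwards [lower (fun x => h x - c x) (hh.sub hc) (fun x => sub_nonneg.2 (hch x))
    (fun x => sub_le_self _ (hc0 x)) (∫ x, h x ∂(Q : Measure Ω) - r)
    (by rw [sub Q hQ]; linarith)] with n hn
  rw [sub _ (hP n), heq n] at hn
  linarith

/-- Weak convergence within a set of couplings of two Borel measures on Polish spaces implies
convergence on all measurable rectangles. -/
theorem tendsto_measureReal_prod_of_mem_couplings {S T : Type*}
    [TopologicalSpace S] [PolishSpace S] [MeasurableSpace S] [BorelSpace S]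
    [TopologicalSpace T] [PolishSpace T] [MeasurableSpace T] [BorelSpace T]
    {σ : Measure S} {τ : Measure T} [IsProbabilityMeasure σ] [IsProbabilityMeasure τ]
    {P : ℕ → ProbabilityMeasure (S × T)} {Q : ProbabilityMeasure (S × T)}
    (hPQ : Tendsto P atTop (𝓝 Q)) (hP : ∀ n, (P n : Measure (S × T)) ∈ Couplings σ τ)
    (hQ : (Q : Measure (S × T)) ∈ Couplings σ τ)
    {A : Set S} {B : Set T} (hA : MeasurableSet A) (hB : MeasurableSet B) :
    Tendsto (fun n => (P n : Measure (S × T)).real (A ×ˢ B)) atTop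
      (𝓝 ((Q : Measure (S × T)).real (A ×ˢ B))) := by
  have lower : ∀ B : Set T, MeasurableSet B → ∀ r < (Q : Measure (S × T)).real (A ×ˢ B),
      ∀ᶠ n in atTop, r < (P n : Measure (S × T)).real (A ×ˢ B) := by
    intro B hB r hr
    obtain ⟨ε, hε, hrε⟩ : ∃ ε > 0, r + 2 * ε < (Q : Measure (S × T)).real (A ×ˢ B) :=
      ⟨((Q : Measure (S × T)).real (A ×ˢ B) - r) / 3, by linarith, by linarith⟩
    obtain ⟨U, hAU, hU, -, hUA⟩ := hA.exists_isOpen_sdiff_lt (measure_ne_top σ A)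
      (ENNReal.ofReal_pos.2 hε).ne'
    obtain ⟨V, hBV, hV, -, hVB⟩ := hB.exists_isOpen_sdiff_lt (measure_ne_top τ B)
      (ENNReal.ofReal_pos.2 hε).ne'
    have open_lt : ∀ᶠ n in atTop, r + 2 * ε < (P n : Measure (S × T)).real (U ×ˢ V) := by
      rcases lt_or_ge (r + 2 * ε) 0 with h0 | h0
      · exact Eventually.of_forall fun n => h0.trans_le measureReal_nonneg
      have hlt : ENNReal.ofReal (r + 2 * ε) < (Q : Measure (S × T)) (U ×ˢ V) := by
        rw [ENNReal.ofReal_lt_iff_lt_toReal h0 (measure_ne_top _ _)]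
        exact hrε.trans_le (measureReal_mono (Set.prod_mono hAU hBV))
      filter_upwards [eventually_lt_of_lt_liminf (hlt.trans_le
        (ProbabilityMeasure.le_liminf_measure_open_of_tendsto hPQ (hU.prod hV)))] with n hn
      exact (ENNReal.ofReal_lt_iff_lt_toReal h0 (measure_ne_top _ _)).1 hn
    filter_upwards [open_lt] with n hn
    obtain ⟨-, h₁, h₂⟩ := hP n
    have hsub : U ×ˢ V ⊆ A ×ˢ B ∪ (Prod.fst ⁻¹' (U \ A) ∪ Prod.snd ⁻¹' (V \ B)) := by
      rintro ⟨x, y⟩ ⟨hx, hy⟩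
      by_cases hxA : x ∈ A <;> by_cases hyB : y ∈ B <;> simp_all
    have e₁ : (P n : Measure (S × T)).real (Prod.fst ⁻¹' (U \ A)) < ε := by
      rw [← map_measureReal_apply measurable_fst (hU.measurableSet.diff hA), h₁]
      exact (ENNReal.lt_ofReal_iff_toReal_lt (measure_ne_top _ _)).1 hUA
    have e₂ : (P n : Measure (S × T)).real (Prod.snd ⁻¹' (V \ B)) < ε := by
      rw [← map_measureReal_apply measurable_snd (hV.measurableSet.diff hB), h₂]
      exact (ENNReal.lt_ofReal_iff_toReal_lt (measure_ne_top _ _)).1 hVB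
    have := (measureReal_mono hsub).trans ((measureReal_union_le _ _).trans
      (add_le_add_right (measureReal_union_le (μ := (P n : Measure (S × T))) _ _) _))
    linarith
  have split : ∀ R : ProbabilityMeasure (S × T), (R : Measure (S × T)) ∈ Couplings σ τ →
      (R : Measure (S × T)).real (A ×ˢ B) + (R : Measure (S × T)).real (A ×ˢ Bᶜ) = σ.real A := by
    rintro R ⟨-, h₁, -⟩
    rw [← measureReal_union (Set.disjoint_left.2 fun p hp hp' => hp'.2 hp.2)
      (hA.prod hB.compl), ← Set.prod_union, Set.union_compl_self, Set.prod_univ,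
      ← map_measureReal_apply measurable_fst hA, h₁]
  refine tendsto_order.2 ⟨lower B hB, fun r hr => ?_⟩
  have hQs := split Q hQ
  filter_upwards [lower Bᶜ hB.compl (σ.real A - r) (by linarith)] with n hn
  have := split _ (hP n)
  linarith

/-- Weak convergence within a set of couplings is preserved by the push-forward under a product of
Borel maps, continuous or not. -/
theorem tendsto_map_prodMap_of_mem_couplings {S T S' T' : Type*}
    [TopologicalSpace S] [PolishSpace S] [MeasurableSpace S] [BorelSpace S]
    [TopologicalSpace T] [PolishSpace T] [MeasurableSpace T] [BorelSpace T]
    [TopologicalSpace S'] [SecondCountableTopology S'] [MeasurableSpace S'] [OpensMeasurableSpace S']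
    [TopologicalSpace T'] [SecondCountableTopology T'] [MeasurableSpace T'] [OpensMeasurableSpace T']
    {σ : Measure S} {τ : Measure T} [IsProbabilityMeasure σ] [IsProbabilityMeasure τ]
    {P : ℕ → ProbabilityMeasure (S × T)} {Q : ProbabilityMeasure (S × T)}
    (hPQ : Tendsto P atTop (𝓝 Q)) (hP : ∀ n, (P n : Measure (S × T)) ∈ Couplings σ τ)
    (hQ : (Q : Measure (S × T)) ∈ Couplings σ τ)
    {a : S → S'} {b : T → T'} (ha : Measurable a) (hb : Measurable b) :
    Tendsto (fun n => (P n).map (ha.prodMap hb).aemeasurable) atTop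
      (𝓝 (Q.map (ha.prodMap hb).aemeasurable)) := by
  let R : Set (Set (S' × T')) := {t | ∃ (A : Set S') (B : Set T'),
    IsOpen A ∧ IsOpen B ∧ t = A ×ˢ B}
  have hR : IsPiSystem R := by
    rintro - ⟨A, B, hA, hB, rfl⟩ - ⟨A', B', hA', hB', rfl⟩ -
    exact ⟨A ∩ A', B ∩ B', hA.inter hA', hB.inter hB', Set.prod_inter_prod⟩
  refine hR.tendsto_probabilityMeasure_of_tendsto_of_mem ?_ ?_ ?_
  · rintro - ⟨A, B, hA, hB, rfl⟩
    exact hA.measurableSet.prod hB.measurableSet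
  · rintro u hu ⟨x, y⟩ hxy
    obtain ⟨A, B, hA, hB, hx, hy, hAB⟩ := isOpen_prod_iff.1 hu x y hxy
    exact ⟨A ×ˢ B, ⟨A, B, hA, hB, rfl⟩, (hA.prod hB).mem_nhds ⟨hx, hy⟩, hAB⟩
  · rintro - ⟨A, B, hA, hB, rfl⟩
    have hAB : MeasurableSet (A ×ˢ B) := hA.measurableSet.prod hB.measurableSet
    have := tendsto_measureReal_prod_of_mem_couplings hPQ hP hQ (ha hA.measurableSet)
      (hb hB.measurableSet)
    rw [← NNReal.tendsto_coe]
    have key : ∀ M : ProbabilityMeasure (S × T),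
        ((M.map (ha.prodMap hb).aemeasurable (A ×ˢ B) : NNReal) : ℝ) =
          (M : Measure (S × T)).real ((a ⁻¹' A) ×ˢ (b ⁻¹' B)) := fun M => by
      rw [ProbabilityMeasure.map_apply _ _ hAB]
      rfl
    simpa only [key] using this

/-- Reordering the square of a coupling of `μ` and `ν` gives a coupling of the squares. -/
theorem map_prodProdProdComm_mem_couplings {X Y : Type*} [MeasurableSpace X] [MeasurableSpace Y]
    {μ : Measure X} {ν : Measure Y} {π : Measure (X × Y)} (hπ : π ∈ Couplings μ ν) :
    (π.prod π).map (fun p => ((p.1.1, p.2.1), (p.1.2, p.2.2))) ∈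
      Couplings (μ.prod μ) (ν.prod ν) := by
  obtain ⟨hprob, h₁, h₂⟩ := hπ
  have hm : Measurable fun p : (X × Y) × (X × Y) => ((p.1.1, p.2.1), (p.1.2, p.2.2)) := by fun_prop
  refine ⟨Measure.isProbabilityMeasure_map hm.aemeasurable, ?_, ?_⟩
  · rw [Measure.map_map measurable_fst hm, ← h₁, Measure.map_prod_map _ _ measurable_fst
      measurable_fst]
    rfl
  · rw [Measure.map_map measurable_snd hm, ← h₂, Measure.map_prod_map _ _ measurable_snd
      measurable_snd]
    rfl

/-- **Weak-convergence continuity of quadratic transport functionals.**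
If `γₙ → γ` weakly in the couplings of `μ` and `ν`, `a, b` are Borel maps into
separable metric spaces, and `c ≥ 0` is continuous with `c(u,v) ≤ f(u) + g(v)` for
continuous `f, g` whose compositions with `a, b` are integrable, then the quadratic
functionals `∬ c(a(x,x'), b(y,y')) dγₙ dγₙ` converge to `∬ c(a(x,x'), b(y,y')) dγ dγ`. -/
theorem weak_convergence_quadratic_continuity
    {X Y XT YT : Type*}
    [MeasurableSpace X] [TopologicalSpace X] [PolishSpace X] [BorelSpace X]
    [MeasurableSpace Y] [TopologicalSpace Y] [PolishSpace Y] [BorelSpace Y]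
    [MetricSpace XT] [TopologicalSpace.SeparableSpace XT] [MeasurableSpace XT] [BorelSpace XT]
    [MetricSpace YT] [TopologicalSpace.SeparableSpace YT] [MeasurableSpace YT] [BorelSpace YT]
    (μ : Measure X) (ν : Measure Y) [IsProbabilityMeasure μ] [IsProbabilityMeasure ν]
    (γseq : ℕ → Measure (X × Y)) (γ : Measure (X × Y))
    (hseq : ∀ n, γseq n ∈ Couplings μ ν) (hγ : γ ∈ Couplings μ ν)
    (a : X × X → XT) (b : Y × Y → YT) (ha : Measurable a) (hb : Measurable b)
    (c : XT × YT → ℝ) (hc : Continuous c) (hc0 : ∀ q, 0 ≤ c q)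
    (f : XT → ℝ) (g : YT → ℝ) (hf : Continuous f) (hg : Continuous g)
    (hcfg : ∀ u v, c (u, v) ≤ f u + g v)
    (hfa : Integrable (fun q : X × X => f (a q)) (μ.prod μ))
    (hgb : Integrable (fun q : Y × Y => g (b q)) (ν.prod ν))
    (hweak : ∀ F : BoundedContinuousFunction (X × Y) ℝ,
      Filter.Tendsto (fun n => ∫ w, F w ∂(γseq n)) Filter.atTop (nhds (∫ w, F w ∂γ))) :
    Filter.Tendsto
      (fun n => ∫ w : X × Y, ∫ w' : X × Y,
        c (a (w.1, w'.1), b (w.2, w'.2)) ∂(γseq n) ∂(γseq n))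
      Filter.atTop
      (nhds (∫ w : X × Y, ∫ w' : X × Y, c (a (w.1, w'.1), b (w.2, w'.2)) ∂γ ∂γ)) := by
  have : SecondCountableTopology XT := UniformSpace.secondCountable_of_separable XT
  have : SecondCountableTopology YT := UniformSpace.secondCountable_of_separable YT
  let G : ℕ → ProbabilityMeasure (X × Y) := fun n => ⟨γseq n, (hseq n).1⟩
  let G' : ProbabilityMeasure (X × Y) := ⟨γ, hγ.1⟩
  have hG : Tendsto G atTop (𝓝 G') :=
    ProbabilityMeasure.tendsto_iff_forall_integral_tendsto.2 hweak
  have hs : Continuous fun p : (X × Y) × (X × Y) => ((p.1.1, p.2.1), (p.1.2, p.2.2)) := by fun_prop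
  let sq : ProbabilityMeasure (X × Y) → ProbabilityMeasure ((X × X) × (Y × Y)) := fun M =>
    (M.prod M).map hs.measurable.aemeasurable
  have hsq : Tendsto (fun n => sq (G n)) atTop (𝓝 (sq G')) :=
    ProbabilityMeasure.tendsto_map_of_tendsto_of_continuous _ _
      ((ProbabilityMeasure.continuous_prod.tendsto (G', G')).comp (hG.prodMk_nhds hG)) hs
  have hmem : ∀ M : ProbabilityMeasure (X × Y), (M : Measure (X × Y)) ∈ Couplings μ ν →
      (sq M : Measure ((X × X) × (Y × Y))) ∈ Couplings (μ.prod μ) (ν.prod ν) := fun M hM =>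
    map_prodProdProdComm_mem_couplings hM
  have hab : Measurable (Prod.map a b) := ha.prodMap hb
  have hlim := tendsto_map_prodMap_of_mem_couplings hsq (fun n => hmem _ (hseq n)) (hmem _ hγ) ha hb
  have hh : Continuous fun q : XT × YT => f q.1 + g q.2 := by fun_prop
  have hint : ∀ M : ProbabilityMeasure (X × Y), (M : Measure (X × Y)) ∈ Couplings μ ν →
      Integrable (fun q : XT × YT => f q.1 + g q.2)
        ((sq M).map hab.aemeasurable : Measure (XT × YT)) ∧
      ∫ q : XT × YT, f q.1 + g q.2 ∂((sq M).map hab.aemeasurable : Measure (XT × YT)) =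
        ∫ q, f (a q) ∂(μ.prod μ) + ∫ q, g (b q) ∂(ν.prod ν) := by
    intro M hM
    obtain ⟨-, h₁, h₂⟩ := hmem M hM
    rw [← h₁] at hfa ⊢
    rw [← h₂] at hgb ⊢
    rw [ProbabilityMeasure.toMeasure_map]
    have i₁ := hfa.comp_measurable measurable_fst
    have i₂ := hgb.comp_measurable measurable_snd
    constructor
    · rw [integrable_map_measure hh.measurable.aestronglyMeasurable hab.aemeasurable]
      exact i₁.add i₂
    · rw [integral_map hab.aemeasurable hh.measurable.aestronglyMeasurable,
        integral_map measurable_fst.aemeasurable hfa.aestronglyMeasurable,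
        integral_map measurable_snd.aemeasurable hgb.aestronglyMeasurable]
      exact integral_add i₁ i₂
  have main := tendsto_integral_of_le_of_integral_eq hlim hc hh hc0 (fun q => hcfg q.1 q.2)
    (fun n => (hint (G n) (hseq n)).1) (hint G' hγ).1
    (fun n => (hint (G n) (hseq n)).2.trans (hint G' hγ).2.symm)
  have iterated : ∀ M : ProbabilityMeasure (X × Y), (M : Measure (X × Y)) ∈ Couplings μ ν →
      ∫ q, c q ∂((sq M).map hab.aemeasurable : Measure (XT × YT)) =
        ∫ w, ∫ w', c (a (w.1, w'.1), b (w.2, w'.2)) ∂(M : Measure (X × Y))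
          ∂(M : Measure (X × Y)) := by
    intro M hM
    have hci : Integrable c ((sq M).map hab.aemeasurable : Measure (XT × YT)) :=
      (hint M hM).1.mono' hc.measurable.aestronglyMeasurable
        (Eventually.of_forall fun q => by rw [Real.norm_of_nonneg (hc0 q)]; exact hcfg q.1 q.2)
    have hmap : ((sq M).map hab.aemeasurable : Measure (XT × YT)) =
        ((M : Measure (X × Y)).prod (M : Measure (X × Y))).map
          (Prod.map a b ∘ fun p => ((p.1.1, p.2.1), (p.1.2, p.2.2))) :=
      Measure.map_map hab hs.measurable
    rw [hmap] at hci ⊢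
    rw [integral_map (hab.comp hs.measurable).aemeasurable hc.measurable.aestronglyMeasurable]
    exact integral_prod _ (hci.comp_measurable (hab.comp hs.measurable))
  rw [iterated G' hγ] at main
  exact main.congr fun n => iterated (G n) (hseq n)
end
end

section
/- Path-connectedness via Hölder continuous paths: Let (Z, d_Z) be a separable metric space and p ∈ [1,∞). For any (Z,p)-networks X = (X, ω_X, μ_X) and Y = (Y, ω_Y, μ_Y), define for t ∈ [0,1] the (Z,p)-network X_t = (X ⊔ Y, ω_X ⊔ ω_Y, (1−t)μ_X + tμ_Y), where ω_X ⊔ ω_Y : (X ⊔ Y)² → Z is any fixed Borel kernel restricting to ω_X on X×X and to ω_Y on Y×Y. Then GW_p^Z(X_0, X) = 0, GW_p^Z(X_1, Y) = 0, and there exists a constant K ≥ 0 (independent of s, t) such that GW_p^Z(X_s, X_t) ≤ K |t − s|^{1/p} for all s, t ∈ [0,1]; in particular any two (Z,p)-networks are joined by a GW_p^Z-continuous path. -/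
open MeasureTheory

noncomputable section

/-- The `p`-distortion of a coupling `π`, for kernels `ωX`, `ωY` valued in a
(pseudo)metric space `Z`. -/
def dis {X Y Z : Type*} [MeasurableSpace X] [MeasurableSpace Y] [PseudoMetricSpace Z]
    (p : ℝ) (ωX : X × X → Z) (ωY : Y × Y → Z) (π : Measure (X × Y)) : ℝ :=
  (∫ w : X × Y, ∫ w' : X × Y,
      dist (ωX (w.1, w'.1)) (ωY (w.2, w'.2)) ^ p ∂π ∂π) ^ (1 / p)

/-- The `Z`-Gromov–Wasserstein `p`-distance between `(X, ωX, μX)` and `(Y, ωY, μY)`. -/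
def GW {X Y Z : Type*} [MeasurableSpace X] [MeasurableSpace Y] [PseudoMetricSpace Z]
    (p : ℝ) (ωX : X × X → Z) (μX : Measure X) (ωY : Y × Y → Z) (μY : Measure Y) : ℝ :=
  (1 / 2) * sInf (dis p ωX ωY '' Couplings μX μY)

/-- `(X, ω, μ)` is a `(Z,p)`-network: `μ` is a Borel probability measure, `ω` is Borel
measurable, and `∬ d_Z(ω(x,x'), z₀)^p dμ dμ < ∞` for some `z₀`. -/
structure IsNetwork {X Z : Type*} [MeasurableSpace X] [MeasurableSpace Z] [PseudoMetricSpace Z]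
    (p : ℝ) (ω : X × X → Z) (μ : Measure X) : Prop where
  prob : IsProbabilityMeasure μ
  meas : Measurable ω
  integ : ∃ z₀ : Z, (∫⁻ x, ∫⁻ x', ENNReal.ofReal (dist (ω (x, x')) z₀ ^ p) ∂μ ∂μ) < ⊤

/-- The measure `(1−t)·μX + t·μY` on the disjoint union `X ⊔ Y`. -/
def mixMeasure {X Y : Type*} [MeasurableSpace X] [MeasurableSpace Y]
    (μX : Measure X) (μY : Measure Y) (t : ℝ) : Measure (X ⊕ Y) :=
  ENNReal.ofReal (1 - t) • μX.map Sum.inl + ENNReal.ofReal t • μY.map Sum.inr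

lemma dis_nonneg {X Y Z : Type*} [MeasurableSpace X] [MeasurableSpace Y] [PseudoMetricSpace Z]
    (p : ℝ) (ωX : X × X → Z) (ωY : Y × Y → Z) (π : Measure (X × Y)) :
    0 ≤ dis p ωX ωY π :=
  Real.rpow_nonneg (integral_nonneg fun _ => integral_nonneg fun _ =>
    Real.rpow_nonneg dist_nonneg _) _

lemma bddBelow_dis_image {X Y Z : Type*} [MeasurableSpace X] [MeasurableSpace Y]
    [PseudoMetricSpace Z] (p : ℝ) (ωX : X × X → Z) (ωY : Y × Y → Z) (A : Set (Measure (X × Y))) :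
    BddBelow (dis p ωX ωY '' A) :=
  ⟨0, by rintro _ ⟨π, -, rfl⟩; exact dis_nonneg p ωX ωY π⟩

lemma GW_nonneg {X Y Z : Type*} [MeasurableSpace X] [MeasurableSpace Y] [PseudoMetricSpace Z]
    (p : ℝ) (ωX : X × X → Z) (μX : Measure X) (ωY : Y × Y → Z) (μY : Measure Y) :
    0 ≤ GW p ωX μX ωY μY := by
  refine mul_nonneg (by norm_num) (Real.sInf_nonneg ?_)
  rintro _ ⟨π, -, rfl⟩
  exact dis_nonneg p ωX ωY π

lemma GW_le_of_mem_couplings {X Y Z : Type*} [MeasurableSpace X] [MeasurableSpace Y]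
    [PseudoMetricSpace Z] {p : ℝ} {ωX : X × X → Z} {μX : Measure X} {ωY : Y × Y → Z}
    {μY : Measure Y} {π : Measure (X × Y)} (hπ : π ∈ Couplings μX μY) :
    GW p ωX μX ωY μY ≤ 1 / 2 * dis p ωX ωY π :=
  mul_le_mul_of_nonneg_left (csInf_le (bddBelow_dis_image p ωX ωY _) ⟨π, hπ, rfl⟩) (by norm_num)

/-- The distortion is controlled by the corresponding lower Lebesgue integral, without any
measurability assumption. -/
lemma dis_le_of_lintegral_le {X Y Z : Type*} [MeasurableSpace X] [MeasurableSpace Y]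
    [PseudoMetricSpace Z] {p : ℝ} (hp : 0 < p) {ωX : X × X → Z} {ωY : Y × Y → Z}
    {π : Measure (X × Y)} {c : ℝ} (hc : 0 ≤ c)
    (h : ∫⁻ w, ∫⁻ w', edist (ωX (w.1, w'.1)) (ωY (w.2, w'.2)) ^ p ∂π ∂π ≤ ENNReal.ofReal c) :
    dis p ωX ωY π ≤ c ^ (1 / p) := by
  refine Real.rpow_le_rpow (integral_nonneg fun _ => integral_nonneg fun _ =>
    Real.rpow_nonneg dist_nonneg _) ?_ (by positivity)
  rw [← ENNReal.ofReal_le_ofReal_iff hc]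
  refine le_trans ?_ h
  rw [← Real.enorm_of_nonneg (integral_nonneg fun _ => integral_nonneg fun _ =>
    Real.rpow_nonneg dist_nonneg _)]
  refine (enorm_integral_le_lintegral_enorm _).trans (lintegral_mono fun w => ?_)
  refine (enorm_integral_le_lintegral_enorm _).trans (lintegral_mono fun w' => ?_)
  rw [Real.enorm_of_nonneg (Real.rpow_nonneg dist_nonneg _),
    ← ENNReal.ofReal_rpow_of_nonneg dist_nonneg hp.le, edist_dist]

/-- Pushing a probability measure forward along a map preserving the kernel does not change the
network up to `GW`-distance zero. -/
lemma GW_map_eq_zero {X S Z : Type*} [MeasurableSpace X] [MeasurableSpace S] [PseudoMetricSpace Z]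
    {p : ℝ} (hp : 0 < p) {ωS : S × S → Z} {ωX : X × X → Z} {μ : Measure X}
    [IsProbabilityMeasure μ] {f : X → S} (hf : Measurable f)
    (h : ∀ x x', ωS (f x, f x') = ωX (x, x')) :
    GW p ωS (μ.map f) ωX μ = 0 := by
  have hm : Measurable fun x => (f x, x) := hf.prodMk measurable_id
  have hπ : μ.map (fun x => (f x, x)) ∈ Couplings (μ.map f) μ := by
    refine ⟨Measure.isProbabilityMeasure_map hm.aemeasurable, ?_, ?_⟩
    · rw [Measure.map_map measurable_fst hm]; rfl
    · rw [Measure.map_map measurable_snd hm]; exact Measure.map_id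
  refine le_antisymm ((GW_le_of_mem_couplings hπ).trans ?_) (GW_nonneg ..)
  have hd : dis p ωS ωX (μ.map fun x => (f x, x)) ≤ 0 ^ (1 / p) := by
    refine dis_le_of_lintegral_le hp le_rfl ?_
    refine (lintegral_map_le _ _).trans ?_
    refine (lintegral_mono fun x => lintegral_map_le _ _).trans ?_
    simp [h, hp]
  rw [Real.zero_rpow (by positivity)] at hd
  linarith

/-- Two convex combinations of `α` and `β` are coupled by keeping the common mass on the diagonal
and transporting the remaining mass by the product coupling. -/
lemma mem_couplings_convexCombination {S : Type*} [MeasurableSpace S] (α β : Measure S)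
    [IsProbabilityMeasure α] [IsProbabilityMeasure β] {s t : ℝ} (hs : 0 ≤ s) (hst : s ≤ t)
    (ht : t ≤ 1) :
    ENNReal.ofReal (1 - t) • α.map (fun x => (x, x)) + ENNReal.ofReal s • β.map (fun x => (x, x))
        + ENNReal.ofReal (t - s) • α.prod β ∈
      Couplings (ENNReal.ofReal (1 - s) • α + ENNReal.ofReal s • β)
        (ENNReal.ofReal (1 - t) • α + ENNReal.ofReal t • β) := by
  have hm : Measurable fun x : S => (x, x) := measurable_id.prodMk measurable_id
  have hfst (μ : Measure S) : (μ.map fun x => (x, x)).map Prod.fst = μ := by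
    rw [Measure.map_map measurable_fst hm]; exact Measure.map_id
  have hsnd (μ : Measure S) : (μ.map fun x => (x, x)).map Prod.snd = μ := by
    rw [Measure.map_map measurable_snd hm]; exact Measure.map_id
  refine ⟨⟨?_⟩, ?_, ?_⟩
  · simp only [Measure.add_apply, Measure.smul_apply, Measure.map_apply hm MeasurableSet.univ,
      Set.preimage_univ, measure_univ, smul_eq_mul, mul_one]
    rw [← ENNReal.ofReal_add (by linarith) hs, ← ENNReal.ofReal_add (by linarith) (by linarith)]
    simp
  · simp only [Measure.map_add _ _ measurable_fst, Measure.map_smul, hfst,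
      Measure.map_fst_prod, measure_univ, one_smul]
    rw [add_right_comm, ← add_smul, ← ENNReal.ofReal_add (by linarith) (by linarith)]
    congr 3; ring
  · simp only [Measure.map_add _ _ measurable_snd, Measure.map_smul, hsnd,
      Measure.map_snd_prod, measure_univ, one_smul]
    rw [add_assoc, ← add_smul, ← ENNReal.ofReal_add hs (by linarith)]
    congr 3; ring

/-- Finiteness of the `p`-distortion integral of a coupling between measures dominated by a
multiple of a measure for which the kernel has finite `p`-th moment. -/
lemma lintegral_edist_rpow_lt_top {S Z : Type*} [MeasurableSpace S] [PseudoMetricSpace Z]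
    [MeasurableSpace Z] [BorelSpace Z] [SecondCountableTopology Z] {p : ℝ} (hp : 1 ≤ p)
    {ω : S × S → Z} (hω : Measurable ω) {N : Measure S} {M : Measure (S × S)} [SFinite N]
    [SFinite M] {c : ENNReal} (hc : c ≠ ⊤) (h₁ : M.map Prod.fst ≤ c • N)
    (h₂ : M.map Prod.snd ≤ c • N)
    {z₀ : Z} (hN : ∫⁻ u, ∫⁻ u', edist (ω (u, u')) z₀ ^ p ∂N ∂N < ⊤) :
    ∫⁻ w, ∫⁻ w', edist (ω (w.1, w'.1)) (ω (w.2, w'.2)) ^ p ∂M ∂M < ⊤ := by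
  have hG : Measurable fun q : S × S => edist (ω q) z₀ ^ p :=
    (hω.edist measurable_const).pow_const p
  have key (f : S × S → S) (hf : Measurable f) (hle : M.map f ≤ c • N) :
      ∫⁻ w, ∫⁻ w', edist (ω (f w, f w')) z₀ ^ p ∂M ∂M < ⊤ := by
    calc ∫⁻ w, ∫⁻ w', edist (ω (f w, f w')) z₀ ^ p ∂M ∂M
        = ∫⁻ u, ∫⁻ u', edist (ω (u, u')) z₀ ^ p ∂(M.map f) ∂(M.map f) := by
          rw [lintegral_map hG.lintegral_prod_right' hf]
          exact lintegral_congr fun w => (lintegral_map (hG.comp measurable_prodMk_left) hf).symm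
      _ ≤ ∫⁻ u, ∫⁻ u', edist (ω (u, u')) z₀ ^ p ∂(c • N) ∂(c • N) :=
          lintegral_mono' hle fun u => lintegral_mono' hle le_rfl
      _ = c * (c * ∫⁻ u, ∫⁻ u', edist (ω (u, u')) z₀ ^ p ∂N ∂N) := by
          simp only [lintegral_smul_measure, smul_eq_mul]
          rw [lintegral_const_mul _ hG.lintegral_prod_right']
      _ < ⊤ := ENNReal.mul_lt_top hc.lt_top (ENNReal.mul_lt_top hc.lt_top hN)
  have hA (f : S × S → S) (hf : Measurable f) :
      Measurable fun q : (S × S) × (S × S) => edist (ω (f q.1, f q.2)) z₀ ^ p :=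
    hG.comp ((hf.comp measurable_fst).prodMk (hf.comp measurable_snd))
  calc ∫⁻ w, ∫⁻ w', edist (ω (w.1, w'.1)) (ω (w.2, w'.2)) ^ p ∂M ∂M
      ≤ ∫⁻ w, ∫⁻ w', 2 ^ (p - 1) * (edist (ω (w.1, w'.1)) z₀ ^ p
          + edist (ω (w.2, w'.2)) z₀ ^ p) ∂M ∂M := by
        refine lintegral_mono fun w => lintegral_mono fun w' => ?_
        refine (ENNReal.rpow_le_rpow (edist_triangle_right _ _ z₀) (by linarith)).trans ?_
        exact ENNReal.rpow_add_le_mul_rpow_add_rpow _ _ hp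
    _ = 2 ^ (p - 1) * (∫⁻ w, ∫⁻ w', edist (ω (w.1, w'.1)) z₀ ^ p ∂M ∂M
          + ∫⁻ w, ∫⁻ w', edist (ω (w.2, w'.2)) z₀ ^ p ∂M ∂M) := by
        have h2 : (2 : ENNReal) ^ (p - 1) ≠ ⊤ :=
          ENNReal.rpow_ne_top_of_nonneg (by linarith) (by simp)
        simp_rw [lintegral_const_mul' _ _ h2]
        rw [← lintegral_add_left (hA _ measurable_fst).lintegral_prod_right']
        congr 1
        exact lintegral_congr fun w =>
          lintegral_add_left ((hA _ measurable_fst).comp measurable_prodMk_left) _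
    _ < ⊤ := ENNReal.mul_lt_top
        (ENNReal.rpow_lt_top_of_nonneg (by linarith) (by simp))
        (ENNReal.add_lt_top.2 ⟨key _ measurable_fst h₁, key _ measurable_snd h₂⟩)

lemma lintegral_lintegral_add_smul_le {T : Type*} [MeasurableSpace T] (D R M : Measure T)
    {δ : ENNReal} (F : T → T → ENNReal) (hD : ∫⁻ w, ∫⁻ w', F w w' ∂D ∂D = 0)
    (hm : Measurable fun w => ∫⁻ w', F w w' ∂D)
    (hDM : D ≤ M) (hRM : R ≤ M) (hπM : D + δ • R ≤ M) (hδ : δ ≠ ⊤) :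
    ∫⁻ w, ∫⁻ w', F w w' ∂(D + δ • R) ∂(D + δ • R) ≤ δ * (2 * ∫⁻ w, ∫⁻ w', F w w' ∂M ∂M) := by
  rw [lintegral_add_measure, lintegral_smul_measure, smul_eq_mul, two_mul, mul_add]
  refine add_le_add ?_ (mul_le_mul_right (lintegral_mono' hRM fun w =>
    lintegral_mono' hπM le_rfl) _)
  simp only [lintegral_add_measure, lintegral_smul_measure, smul_eq_mul]
  rw [lintegral_add_left hm, hD, zero_add, lintegral_const_mul' _ _ hδ]
  exact mul_le_mul_right (lintegral_mono' hDM fun w => lintegral_mono' hRM le_rfl) _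

/-- Convex combinations of two probability measures on a common space form a Hölder path. -/
lemma exists_GW_convexCombination_le {S Z : Type*} [MeasurableSpace S] [PseudoMetricSpace Z]
    [MeasurableSpace Z] [BorelSpace Z] [SecondCountableTopology Z] {p : ℝ} (hp : 1 ≤ p)
    {ω : S × S → Z} (hω : Measurable ω) (α β : Measure S)
    [IsProbabilityMeasure α] [IsProbabilityMeasure β]
    {z₀ : Z} (h : ∫⁻ u, ∫⁻ u', edist (ω (u, u')) z₀ ^ p ∂(α + β) ∂(α + β) < ⊤) :
    ∃ K : ℝ, 0 ≤ K ∧ ∀ s t : ℝ, 0 ≤ s → s ≤ t → t ≤ 1 →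
      GW p ω (ENNReal.ofReal (1 - s) • α + ENNReal.ofReal s • β)
        ω (ENNReal.ofReal (1 - t) • α + ENNReal.ofReal t • β) ≤ K * |t - s| ^ (1 / p) := by
  have hm : Measurable fun x : S => (x, x) := measurable_id.prodMk measurable_id
  have hfst (μ : Measure S) : (μ.map fun x => (x, x)).map Prod.fst = μ := by
    rw [Measure.map_map measurable_fst hm]; exact Measure.map_id
  have hsnd (μ : Measure S) : (μ.map fun x => (x, x)).map Prod.snd = μ := by
    rw [Measure.map_map measurable_snd hm]; exact Measure.map_id
  set M : Measure (S × S) := α.map (fun x => (x, x)) + β.map (fun x => (x, x)) + α.prod β with hM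
  have hC : ∫⁻ w, ∫⁻ w', edist (ω (w.1, w'.1)) (ω (w.2, w'.2)) ^ p ∂M ∂M < ⊤ := by
    refine lintegral_edist_rpow_lt_top hp hω (c := 2) (by simp) ?_ ?_ h
    · rw [hM, Measure.map_add _ _ measurable_fst, Measure.map_add _ _ measurable_fst, hfst, hfst,
        Measure.map_fst_prod, measure_univ, one_smul, two_smul]
      exact add_le_add le_rfl (Measure.le_add_right le_rfl)
    · rw [hM, Measure.map_add _ _ measurable_snd, Measure.map_add _ _ measurable_snd, hsnd, hsnd,
        Measure.map_snd_prod, measure_univ, one_smul, two_smul]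
      exact add_le_add le_rfl (Measure.le_add_left le_rfl)
  set C := ∫⁻ w, ∫⁻ w', edist (ω (w.1, w'.1)) (ω (w.2, w'.2)) ^ p ∂M ∂M with hCdef
  refine ⟨1 / 2 * (2 * C.toReal) ^ (1 / p), by positivity, fun s t hs hst ht => ?_⟩
  refine (GW_le_of_mem_couplings (mem_couplings_convexCombination α β hs hst ht)).trans ?_
  rw [abs_of_nonneg (sub_nonneg.2 hst), mul_assoc,
    ← Real.mul_rpow (by positivity) (sub_nonneg.2 hst)]
  refine mul_le_mul_of_nonneg_left ?_ (by norm_num)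
  have hts := sub_nonneg.2 hst
  refine dis_le_of_lintegral_le (by linarith) (by positivity) ?_
  have hle (a : ℝ) (ha : a ≤ 1) (μ : Measure (S × S)) : ENNReal.ofReal a • μ ≤ μ := by
    intro A
    simpa using mul_le_mul_left (ENNReal.ofReal_le_one.2 ha) (μ A)
  have hDM := add_le_add (hle (1 - t) (by linarith) (α.map fun x => (x, x)))
    (hle s (by linarith) (β.map fun x => (x, x)))
  rw [show ENNReal.ofReal (2 * C.toReal * (t - s)) = ENNReal.ofReal (t - s) * (2 * C) by
    rw [mul_comm, ENNReal.ofReal_mul hts, ENNReal.ofReal_mul (by norm_num),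
      ENNReal.ofReal_toReal hC.ne]
    simp]
  have hF : Measurable fun q : (S × S) × (S × S) =>
      edist (ω (q.1.1, q.2.1)) (ω (q.1.2, q.2.2)) ^ p :=
    ((hω.comp (by fun_prop)).edist (hω.comp (by fun_prop))).pow_const p
  refine lintegral_lintegral_add_smul_le _ _ M
    (fun w w' => edist (ω (w.1, w'.1)) (ω (w.2, w'.2)) ^ p) ?_ hF.lintegral_prod_right'
    (hDM.trans (Measure.le_add_right le_rfl)) (Measure.le_add_left le_rfl)
    (add_le_add hDM (hle _ (by linarith) _)) ENNReal.ofReal_ne_top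
  have hp0 : 0 < p := by linarith
  have hdiag (μ ν : Measure S) :
      ∫⁻ w, ∫⁻ w', edist (ω (w.1, w'.1)) (ω (w.2, w'.2)) ^ p ∂(μ.map fun x => (x, x))
        ∂(ν.map fun x => (x, x)) = 0 := by
    refine le_antisymm ((lintegral_map_le _ _).trans
      ((lintegral_mono fun x => lintegral_map_le _ _).trans ?_)) bot_le
    simp [hp0]
  rw [← Measure.map_smul, ← Measure.map_smul, ← Measure.map_add _ _ hm]
  exact hdiag _ _

/-- **Path-connectedness via Hölder continuous paths**: for `(Z,p)`-networks `X` and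
`Y` and a Borel kernel on `X ⊔ Y` restricting to `ωX` and `ωY`, the family
`X_t = (X ⊔ Y, ωX ⊔ ωY, (1−t)μX + tμY)` satisfies `GW(X_0, X) = 0`, `GW(X_1, Y) = 0`,
and is `(1/p)`-Hölder in `t`; in particular any two `(Z,p)`-networks are joined by a
`GW_p^Z`-continuous path. -/
theorem gw_path_connected
    {X Y Z : Type*}
    [MeasurableSpace X] [TopologicalSpace X] [PolishSpace X] [BorelSpace X]
    [MeasurableSpace Y] [TopologicalSpace Y] [PolishSpace Y] [BorelSpace Y]
    [MetricSpace Z] [MeasurableSpace Z] [BorelSpace Z] [TopologicalSpace.SeparableSpace Z]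
    (p : ℝ) (hp : 1 ≤ p)
    (ωX : X × X → Z) (μX : Measure X) (hX : IsNetwork p ωX μX)
    (ωY : Y × Y → Z) (μY : Measure Y) (hY : IsNetwork p ωY μY)
    (ωS : (X ⊕ Y) × (X ⊕ Y) → Z) (hωS : Measurable ωS)
    (hl : ∀ x x' : X, ωS (Sum.inl x, Sum.inl x') = ωX (x, x'))
    (hr : ∀ y y' : Y, ωS (Sum.inr y, Sum.inr y') = ωY (y, y'))
    (hSint : ∃ z₀ : Z,
      (∫⁻ u, ∫⁻ u', ENNReal.ofReal (dist (ωS (u, u')) z₀ ^ p)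
        ∂(μX.map Sum.inl + μY.map Sum.inr) ∂(μX.map Sum.inl + μY.map Sum.inr)) < ⊤) :
    GW p ωS (mixMeasure μX μY 0) ωX μX = 0 ∧
    GW p ωS (mixMeasure μX μY 1) ωY μY = 0 ∧
    ∃ K : ℝ, 0 ≤ K ∧
      ∀ s ∈ Set.Icc (0 : ℝ) 1, ∀ t ∈ Set.Icc (0 : ℝ) 1,
        GW p ωS (mixMeasure μX μY s) ωS (mixMeasure μX μY t) ≤ K * |t - s| ^ (1 / p) := by
  have hp0 : 0 < p := by linarith
  have := hX.prob
  have := hY.prob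
  have := UniformSpace.secondCountable_of_separable Z
  refine ⟨?_, ?_, ?_⟩
  · rw [show mixMeasure μX μY 0 = μX.map Sum.inl by simp [mixMeasure]]
    exact GW_map_eq_zero hp0 measurable_inl hl
  · rw [show mixMeasure μX μY 1 = μY.map Sum.inr by simp [mixMeasure]]
    exact GW_map_eq_zero hp0 measurable_inr hr
  obtain ⟨z₀, hz⟩ := hSint
  simp_rw [← ENNReal.ofReal_rpow_of_nonneg dist_nonneg hp0.le, ← edist_dist] at hz
  have := Measure.isProbabilityMeasure_map (μ := μX) (f := (Sum.inl : X → X ⊕ Y))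
    measurable_inl.aemeasurable
  have := Measure.isProbabilityMeasure_map (μ := μY) (f := (Sum.inr : Y → X ⊕ Y))
    measurable_inr.aemeasurable
  obtain ⟨K₁, hK₁, h₁⟩ := exists_GW_convexCombination_le hp hωS _ _ hz
  rw [add_comm] at hz
  obtain ⟨K₂, hK₂, h₂⟩ := exists_GW_convexCombination_le hp hωS _ _ hz
  refine ⟨max K₁ K₂, le_max_of_le_left hK₁, fun s hs t ht => ?_⟩
  rcases le_total s t with hst | hst
  · exact (h₁ s t hs.1 hst ht.2).trans
      (mul_le_mul_of_nonneg_right (le_max_left _ _) (by positivity))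
  · have h := h₂ (1 - s) (1 - t) (by linarith [hs.2]) (by linarith) (by linarith [ht.1])
    rw [sub_sub_cancel, sub_sub_cancel, add_comm, add_comm (ENNReal.ofReal t • _),
      show 1 - t - (1 - s) = -(t - s) by ring, abs_neg] at h
    exact h.trans (mul_le_mul_of_nonneg_right (le_max_right _ _) (by positivity))
end
end

section
/- Third lower bound (TLB): Let (Z, d_Z) be a separable metric space, p ∈ [1,∞), and let X, Y be (Z,p)-networks. Define the outgoing joint eccentricity ecc^out_{p,X,Y}(x,y) = inf_{ν ∈ C(μ_X,μ_Y)} (∫_{X×Y} d_Z(ω_X(x,x'), ω_Y(y,y'))^p ν(dx'×dy'))^{1/p}. Then GW_p^Z(X,Y) ≥ (1/2) inf_{π ∈ C(μ_X,μ_Y)} (∫_{X×Y} ecc^out_{p,X,Y}(x,y)^p π(dx×dy))^{1/p}, and moreover this lower bound equals (1/2) inf_{π ∈ C(μ_X,μ_Y)} (∫_{X×Y} W_p(ω_X(x,·)_*μ_X, ω_Y(y,·)_*μ_Y)^p π(dx×dy))^{1/p}, where W_p is the Wasserstein distance on (Z, d_Z). -/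
open MeasureTheory

noncomputable section

/-- The Wasserstein `p`-distance between two measures on a (pseudo)metric space. -/
def Wp {S : Type*} [MeasurableSpace S] [PseudoMetricSpace S]
    (p : ℝ) (μ ν : Measure S) : ℝ :=
  sInf ((fun π : Measure (S × S) => (∫ q, dist q.1 q.2 ^ p ∂π) ^ (1 / p)) ''
    Couplings μ ν)

/-- The outgoing joint eccentricity function of two networks. -/
def eccOutJoint {X Y Z : Type*} [MeasurableSpace X] [MeasurableSpace Y]
    [PseudoMetricSpace Z]
    (p : ℝ) (ωX : X × X → Z) (μX : Measure X) (ωY : Y × Y → Z) (μY : Measure Y)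
    (x : X) (y : Y) : ℝ :=
  sInf ((fun ν : Measure (X × Y) =>
      (∫ q, dist (ωX (x, q.1)) (ωY (y, q.2)) ^ p ∂ν) ^ (1 / p)) '' Couplings μX μY)

open ProbabilityTheory

/-- If `f` pushes `μ` forward to `μ.map f`, the conditional distribution of the identity given `f`
is concentrated on the fibres of `f`. -/
lemma ae_condDistrib_id_fiber {X Z : Type*} [MeasurableSpace X] [StandardBorelSpace X] [Nonempty X]
    [MeasurableSpace Z] [MeasurableEq Z] {μ : Measure X} [IsFiniteMeasure μ]
    {f : X → Z} (hf : Measurable f) :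
    ∀ᵐ z ∂(μ.map f), ∀ᵐ x ∂(condDistrib id f μ z), f x = z := by
  apply Measure.ae_ae_of_ae_compProd (p := fun q : Z × X => f q.2 = q.1)
  rw [compProd_map_condDistrib aemeasurable_id,
    ae_map_iff (by fun_prop) (measurableSet_eq_fun (by fun_prop) (by fun_prop))]
  exact ae_of_all _ fun _ => rfl

/-- A coupling of pushforward measures lifts to a coupling of the original measures, jointly with
which it is supported on the graph of the pushforward maps. -/
lemma exists_coupling_lift {X Y Z W : Type*} [MeasurableSpace X] [StandardBorelSpace X]
    [MeasurableSpace Y] [StandardBorelSpace Y] [MeasurableSpace Z] [MeasurableEq Z]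
    [MeasurableSpace W] [MeasurableEq W]
    {μ : Measure X} [IsProbabilityMeasure μ] {ν : Measure Y} [IsProbabilityMeasure ν]
    {f : X → Z} (hf : Measurable f) {g : Y → W} (hg : Measurable g)
    {γ : Measure (Z × W)} (hγ : γ ∈ Couplings (μ.map f) (ν.map g)) :
    ∃ π ∈ Couplings μ ν, π.map (Prod.map f g) = γ := by
  obtain ⟨hγp, h1, h2⟩ := hγ
  have : Nonempty X := μ.nonempty_of_neZero
  have : Nonempty Y := ν.nonempty_of_neZero
  let K := condDistrib id f μ
  let L := condDistrib id g ν
  refine ⟨(K ∥ₖ L) ∘ₘ γ, ⟨inferInstance, ?_, ?_⟩, ?_⟩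
  · have hf_comp : condDistrib id f μ ∘ₘ μ.map f = μ := by
      rw [condDistrib_comp_map hf.aemeasurable aemeasurable_id, Measure.map_id]
    rw [← hf_comp, ← h1]
    ext s hs
    rw [Measure.map_apply measurable_fst hs, Measure.bind_apply (measurable_fst hs) (by fun_prop),
      Measure.bind_apply hs (by fun_prop),
      lintegral_map (Kernel.measurable_coe _ hs) measurable_fst]
    refine lintegral_congr fun q => ?_
    rw [Kernel.parallelComp_apply, ← Set.prod_univ, Measure.prod_prod]
    simp [K]
  · have hg_comp : condDistrib id g ν ∘ₘ ν.map g = ν := by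
      rw [condDistrib_comp_map hg.aemeasurable aemeasurable_id, Measure.map_id]
    rw [← hg_comp, ← h2]
    ext s hs
    rw [Measure.map_apply measurable_snd hs, Measure.bind_apply (measurable_snd hs) (by fun_prop),
      Measure.bind_apply hs (by fun_prop),
      lintegral_map (Kernel.measurable_coe _ hs) measurable_snd]
    refine lintegral_congr fun q => ?_
    rw [Kernel.parallelComp_apply, ← Set.univ_prod, Measure.prod_prod]
    simp [L]
  · have hK : ∀ᵐ q ∂γ, ∀ᵐ x ∂(K q.1), f x = q.1 :=
      ae_of_ae_map measurable_fst.aemeasurable (h1 ▸ ae_condDistrib_id_fiber (μ := μ) hf)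
    have hL : ∀ᵐ q ∂γ, ∀ᵐ y ∂(L q.2), g y = q.2 :=
      ae_of_ae_map measurable_snd.aemeasurable (h2 ▸ ae_condDistrib_id_fiber (μ := ν) hg)
    have hfg : Measurable (Prod.map f g) := hf.prodMap hg
    ext s hs
    rw [Measure.map_apply hfg hs, Measure.bind_apply (hfg hs) (by fun_prop),
      ← lintegral_indicator_one hs]
    refine lintegral_congr_ae ?_
    filter_upwards [hK, hL] with q hq1 hq2
    have h : ∀ᵐ w ∂((K q.1).prod (L q.2)), Prod.map f g w = q := by
      filter_upwards [Measure.quasiMeasurePreserving_fst.ae hq1,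
        Measure.quasiMeasurePreserving_snd.ae hq2] with w h1 h2
      exact Prod.ext h1 h2
    rw [Kernel.parallelComp_apply]
    by_cases hqs : q ∈ s
    · rw [Set.indicator_of_mem hqs, Pi.one_apply, ← prob_compl_eq_zero_iff (hfg hs)]
      exact ae_iff.mp (h.mono fun w hw => show Prod.map f g w ∈ s from hw ▸ hqs)
    · rw [Set.indicator_of_notMem hqs]
      exact measure_eq_zero_iff_ae_notMem.mpr (h.mono fun w hw hws => hqs (hw ▸ hws))

lemma map_mem_couplings {X Y Z W : Type*} [MeasurableSpace X] [MeasurableSpace Y]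
    [MeasurableSpace Z] [MeasurableSpace W] {μ : Measure X} {ν : Measure Y}
    {f : X → Z} (hf : Measurable f) {g : Y → W} (hg : Measurable g)
    {π : Measure (X × Y)} (hπ : π ∈ Couplings μ ν) :
    π.map (Prod.map f g) ∈ Couplings (μ.map f) (ν.map g) := by
  obtain ⟨hp, rfl, rfl⟩ := hπ
  have hfg : Measurable (Prod.map f g) := hf.prodMap hg
  refine ⟨Measure.isProbabilityMeasure_map hfg.aemeasurable, ?_, ?_⟩
  · rw [Measure.map_map measurable_fst hfg, Measure.map_map hf measurable_fst]
    rfl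
  · rw [Measure.map_map measurable_snd hfg, Measure.map_map hg measurable_snd]
    rfl

/-- The outgoing joint eccentricity is the Wasserstein distance between the pushforwards of the
measures under the outgoing network functions. -/
lemma eccOutJoint_eq_Wp {X Y Z : Type*} [MeasurableSpace X] [StandardBorelSpace X]
    [MeasurableSpace Y] [StandardBorelSpace Y] [MetricSpace Z] [MeasurableSpace Z] [BorelSpace Z]
    [SecondCountableTopology Z] (p : ℝ)
    {ωX : X × X → Z} (hωX : Measurable ωX) (μX : Measure X) [IsProbabilityMeasure μX]
    {ωY : Y × Y → Z} (hωY : Measurable ωY) (μY : Measure Y) [IsProbabilityMeasure μY]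
    (x : X) (y : Y) :
    eccOutJoint p ωX μX ωY μY x y =
      Wp p (μX.map fun x' => ωX (x, x')) (μY.map fun y' => ωY (y, y')) := by
  have hf : Measurable fun x' => ωX (x, x') := by fun_prop
  have hg : Measurable fun y' => ωY (y, y') := by fun_prop
  have key (π : Measure (X × Y)) :
      ∫ q, dist q.1 q.2 ^ p ∂(π.map (Prod.map (fun x' => ωX (x, x')) fun y' => ωY (y, y'))) =
        ∫ q, dist (ωX (x, q.1)) (ωY (y, q.2)) ^ p ∂π := by
    refine integral_map (hf.prodMap hg).aemeasurable ?_
    have : Measurable fun q : Z × Z => dist q.1 q.2 ^ p := by fun_prop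
    exact this.aestronglyMeasurable
  unfold eccOutJoint Wp
  congr 1
  ext r
  constructor
  · rintro ⟨π, hπ, rfl⟩
    exact ⟨_, map_mem_couplings hf hg hπ, by simp only [key]⟩
  · rintro ⟨γ, hγ, rfl⟩
    obtain ⟨π, hπ, rfl⟩ := exists_coupling_lift hf hg hγ
    exact ⟨π, hπ, by simp only [key]⟩

lemma IsNetwork.memLp_dist {X Z : Type*} [MeasurableSpace X] [PseudoMetricSpace Z]
    [MeasurableSpace Z] [OpensMeasurableSpace Z] {p : ℝ} (hp : 0 < p)
    {ω : X × X → Z} {μ : Measure X} (h : IsNetwork p ω μ) :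
    ∃ z₀, MemLp (fun q => dist (ω q) z₀) (ENNReal.ofReal p) (μ.prod μ) := by
  obtain ⟨hprob, hω, z₀, hz⟩ := h
  have hm : Measurable fun q => dist (ω q) z₀ :=
    (continuous_id.dist continuous_const).measurable.comp hω
  refine ⟨z₀, hm.aestronglyMeasurable, ?_⟩
  rw [eLpNorm_lt_top_iff_lintegral_rpow_enorm_lt_top (by simpa using hp) ENNReal.ofReal_ne_top,
    ENNReal.toReal_ofReal hp.le, lintegral_prod _ (by fun_prop)]
  convert hz using 5 with x x'
  rw [Real.enorm_eq_ofReal dist_nonneg, ENNReal.ofReal_rpow_of_nonneg dist_nonneg hp.le]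

/-- The integrand of the `p`-distortion of a coupling of two networks is integrable. -/
lemma integrable_dist_rpow {X Y Z : Type*} [MeasurableSpace X] [MeasurableSpace Y]
    [PseudoMetricSpace Z] [MeasurableSpace Z] [BorelSpace Z] [SecondCountableTopology Z]
    {p : ℝ} (hp : 0 < p) {ωX : X × X → Z} {μX : Measure X} (hX : IsNetwork p ωX μX)
    {ωY : Y × Y → Z} {μY : Measure Y} (hY : IsNetwork p ωY μY)
    {π : Measure (X × Y)} (hπ : π ∈ Couplings μX μY) :
    Integrable (fun w : (X × Y) × (X × Y) =>
      dist (ωX (w.1.1, w.2.1)) (ωY (w.1.2, w.2.2)) ^ p) (π.prod π) := by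
  have hωX := hX.meas
  have hωY := hY.meas
  obtain ⟨a, ha⟩ := hX.memLp_dist hp
  obtain ⟨b, hb⟩ := hY.memLp_dist hp
  obtain ⟨hprob, rfl, rfl⟩ := hπ
  have h1 : MeasurePreserving (Prod.fst : X × Y → X) π (π.map Prod.fst) := ⟨measurable_fst, rfl⟩
  have h2 : MeasurePreserving (Prod.snd : X × Y → Y) π (π.map Prod.snd) := ⟨measurable_snd, rfl⟩
  have := hX.prob
  have := hY.prob
  have ha' := ha.comp_measurePreserving (h1.prod h1)
  have hb' := hb.comp_measurePreserving (h2.prod h2)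
  have hsum := (ha'.add (memLp_const (dist a b))).add hb'
  have hm : Measurable fun w : (X × Y) × (X × Y) =>
      dist (ωX (w.1.1, w.2.1)) (ωY (w.1.2, w.2.2)) := by fun_prop
  have hd := hsum.mono hm.aestronglyMeasurable <| ae_of_all _ fun w => by
    refine le_trans ?_ (le_abs_self _)
    rw [Real.norm_of_nonneg dist_nonneg]
    simpa [Prod.map, dist_comm] using dist_triangle4 (ωX (w.1.1, w.2.1)) a b (ωY (w.1.2, w.2.2))
  simpa [ENNReal.toReal_ofReal hp.le] using
    hd.integrable_norm_rpow (by simpa using hp) ENNReal.ofReal_ne_top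

/-- The `L^p` norm of the outgoing joint eccentricity with respect to a coupling is at most the
`p`-distortion of that coupling. -/
lemma eccOutJoint_norm_le_dis {X Y Z : Type*} [MeasurableSpace X] [MeasurableSpace Y]
    [PseudoMetricSpace Z] [MeasurableSpace Z] [BorelSpace Z] [SecondCountableTopology Z]
    {p : ℝ} (hp : 0 < p) {ωX : X × X → Z} {μX : Measure X} (hX : IsNetwork p ωX μX)
    {ωY : Y × Y → Z} {μY : Measure Y} (hY : IsNetwork p ωY μY)
    {π : Measure (X × Y)} (hπ : π ∈ Couplings μX μY) :
    (∫ q, eccOutJoint p ωX μX ωY μY q.1 q.2 ^ p ∂π) ^ (1 / p) ≤ dis p ωX ωY π := by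
  have hprob := hπ.1
  have hint (ν : Measure (X × Y)) (q : X × Y) :
      0 ≤ ∫ w, dist (ωX (q.1, w.1)) (ωY (q.2, w.2)) ^ p ∂ν := by positivity
  have hecc (q : X × Y) : 0 ≤ eccOutJoint p ωX μX ωY μY q.1 q.2 :=
    Real.sInf_nonneg <| by
      rintro _ ⟨ν, -, rfl⟩
      exact Real.rpow_nonneg (hint ν q) _
  refine Real.rpow_le_rpow (integral_nonneg fun q => Real.rpow_nonneg (hecc q) _) ?_ (by positivity)
  refine integral_mono_of_nonneg (ae_of_all _ fun q => Real.rpow_nonneg (hecc q) _)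
    (integrable_dist_rpow hp hX hY hπ).integral_prod_left (ae_of_all _ fun q => ?_)
  have hle : eccOutJoint p ωX μX ωY μY q.1 q.2 ≤
      (∫ w, dist (ωX (q.1, w.1)) (ωY (q.2, w.2)) ^ p ∂π) ^ (1 / p) := by
    refine csInf_le ⟨0, ?_⟩ ⟨π, hπ, rfl⟩
    rintro _ ⟨ν, -, rfl⟩
    exact Real.rpow_nonneg (hint ν q) _
  refine (Real.rpow_le_rpow (hecc q) hle hp.le).trans_eq ?_
  rw [one_div, Real.rpow_inv_rpow (hint π q) hp.ne']

lemma couplings_nonempty {X Y : Type*} [MeasurableSpace X] [MeasurableSpace Y]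
    (μ : Measure X) [IsProbabilityMeasure μ] (ν : Measure Y) [IsProbabilityMeasure ν] :
    (Couplings μ ν).Nonempty :=
  ⟨μ.prod ν, inferInstance, by simp, by simp⟩

/-- **Third lower bound (TLB)**: the `Z`-Gromov–Wasserstein distance is bounded below by
half the infimum over couplings of the `L^p`-norm of the outgoing joint eccentricity,
which in turn equals half the infimum over couplings of the `L^p`-norm of
`(x,y) ↦ W_p(ω_X(x,·)_*μ_X, ω_Y(y,·)_*μ_Y)`. -/
theorem gw_third_lower_bound
    {X Y Z : Type*}
    [MeasurableSpace X] [TopologicalSpace X] [PolishSpace X] [BorelSpace X]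
    [MeasurableSpace Y] [TopologicalSpace Y] [PolishSpace Y] [BorelSpace Y]
    [MetricSpace Z] [MeasurableSpace Z] [BorelSpace Z] [TopologicalSpace.SeparableSpace Z]
    (p : ℝ) (hp : 1 ≤ p)
    (ωX : X × X → Z) (μX : Measure X) (hX : IsNetwork p ωX μX)
    (ωY : Y × Y → Z) (μY : Measure Y) (hY : IsNetwork p ωY μY) :
    GW p ωX μX ωY μY ≥
      (1 / 2) * sInf ((fun π : Measure (X × Y) =>
        (∫ q, eccOutJoint p ωX μX ωY μY q.1 q.2 ^ p ∂π) ^ (1 / p)) ''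
          Couplings μX μY) ∧
    (1 / 2) * sInf ((fun π : Measure (X × Y) =>
        (∫ q, eccOutJoint p ωX μX ωY μY q.1 q.2 ^ p ∂π) ^ (1 / p)) ''
          Couplings μX μY) =
      (1 / 2) * sInf ((fun π : Measure (X × Y) =>
        (∫ q, Wp p (μX.map (fun x' => ωX (q.1, x'))) (μY.map (fun y' => ωY (q.2, y')))
            ^ p ∂π) ^ (1 / p)) '' Couplings μX μY) := by
  have hp0 : 0 < p := one_pos.trans_le hp
  have := hX.prob
  have := hY.prob
  have : SecondCountableTopology Z := UniformSpace.secondCountable_of_separable Z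
  refine ⟨?_, by simp_rw [eccOutJoint_eq_Wp p hX.meas μX hY.meas μY]⟩
  refine mul_le_mul_of_nonneg_left ?_ (by norm_num)
  refine le_csInf ((couplings_nonempty μX μY).image _) ?_
  rintro _ ⟨π, hπ, rfl⟩
  refine (csInf_le ⟨0, ?_⟩ (Set.mem_image_of_mem _ hπ)).trans (eccOutJoint_norm_le_dis hp0 hX hY hπ)
  rintro _ ⟨ν, -, rfl⟩
  refine Real.rpow_nonneg (integral_nonneg fun q => Real.rpow_nonneg (Real.sInf_nonneg ?_) _) _
  rintro _ ⟨ν', -, rfl⟩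
  exact Real.rpow_nonneg (integral_nonneg fun _ => by positivity) _
end
end

section
/- Second lower bound (SLB): Let (Z, d_Z) be a separable metric space, p ∈ [1,∞), and let X, Y be (Z,p)-networks. Then GW_p^Z(X,Y) ≥ (1/2) inf_{σ ∈ C(μ_X⊗μ_X, μ_Y⊗μ_Y)} (∫ d_Z(ω_X(x,x'), ω_Y(y,y'))^p σ(d(x,x')×d(y,y')))^{1/p}, and this lower bound equals (1/2) W_p((ω_X)_*(μ_X⊗μ_X), (ω_Y)_*(μ_Y⊗μ_Y)), the Wasserstein distance on (Z, d_Z) between the pushforward distributions of the kernels. -/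
open MeasureTheory

noncomputable section

/-- Couplings lift along a measurable map on the left marginal. -/
theorem exists_coupling_map_left {A W Z : Type*} [MeasurableSpace A] [StandardBorelSpace A]
    [MeasurableSpace W] [MeasurableSpace Z] [MeasurableEq Z]
    {μ : Measure A} [IsProbabilityMeasure μ] {ν : Measure W} {f : A → Z} (hf : Measurable f)
    {γ : Measure (Z × W)} (hγ : γ ∈ Couplings (μ.map f) ν) :
    ∃ σ ∈ Couplings μ ν, σ.map (Prod.map f id) = γ := by
  obtain ⟨hγp, hγ₁, hγ₂⟩ := hγ
  have : Nonempty A := nonempty_of_isProbabilityMeasure μ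
  let κ := ProbabilityTheory.condDistrib id f μ
  let ρ : Measure ((Z × W) × A) := γ.compProd (κ.comap Prod.fst measurable_fst)
  have hρ : ρ.map (fun q => (q.1.1, q.2)) = μ.map (fun a => (f a, a)) := by
    have h : (μ.map f).compProd κ = μ.map (fun a => (f a, a)) :=
      ProbabilityTheory.compProd_map_condDistrib measurable_id.aemeasurable
    rw [← h, ← hγ₁]
    ext s hs
    rw [Measure.map_apply (by fun_prop) hs, Measure.compProd_apply hs,
      Measure.compProd_apply (by measurability),
      lintegral_map (ProbabilityTheory.Kernel.measurable_kernel_prodMk_left hs) measurable_fst]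
    rfl
  have hρfst : ρ.map Prod.fst = γ := Measure.fst_compProd _ _
  have hρsnd : ρ.map Prod.snd = μ := by
    have h := congrArg (Measure.map Prod.snd) hρ
    rw [Measure.map_map measurable_snd (by fun_prop),
      Measure.map_map measurable_snd (by fun_prop)] at h
    exact h.trans Measure.map_id
  have hae : ∀ᵐ q ∂ρ, q.1.1 = f q.2 := by
    have hs : MeasurableSet {r : Z × A | r.1 = f r.2} :=
      measurableSet_eq_fun measurable_fst (hf.comp measurable_snd)
    have h : ∀ᵐ r ∂(ρ.map (fun q => (q.1.1, q.2))), r.1 = f r.2 := by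
      rw [hρ, ae_map_iff (by fun_prop) hs]
      exact ae_of_all _ fun _ => rfl
    exact ae_of_ae_map (by fun_prop) h
  refine ⟨ρ.map (fun q => (q.2, q.1.2)), ⟨?_, ?_, ?_⟩, ?_⟩
  · exact Measure.isProbabilityMeasure_map (by fun_prop)
  · rw [Measure.map_map measurable_fst (by fun_prop)]
    exact hρsnd
  · rw [Measure.map_map measurable_snd (by fun_prop), ← hγ₂, ← hρfst,
      Measure.map_map measurable_snd measurable_fst]
    rfl
  · rw [Measure.map_map (by fun_prop) (by fun_prop), ← hρfst]
    refine Measure.map_congr ?_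
    filter_upwards [hae] with q hq
    exact Prod.ext hq.symm rfl

theorem map_swap_mem_couplings {A B : Type*} [MeasurableSpace A] [MeasurableSpace B]
    {μ : Measure A} {ν : Measure B} {π : Measure (A × B)} (hπ : π ∈ Couplings μ ν) :
    π.map Prod.swap ∈ Couplings ν μ := by
  obtain ⟨h, h₁, h₂⟩ := hπ
  refine ⟨Measure.isProbabilityMeasure_map (by fun_prop), ?_, ?_⟩
  · rw [Measure.map_map measurable_fst measurable_swap]
    exact h₂
  · rw [Measure.map_map measurable_snd measurable_swap]
    exact h₁

/-- Couplings of two pushforward measures are exactly the pushforwards of couplings. -/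
theorem couplings_map {A B Z W : Type*} [MeasurableSpace A] [StandardBorelSpace A]
    [MeasurableSpace B] [StandardBorelSpace B] [MeasurableSpace Z] [MeasurableEq Z]
    [MeasurableSpace W] [MeasurableEq W]
    (μ : Measure A) [IsProbabilityMeasure μ] (ν : Measure B) [IsProbabilityMeasure ν]
    {f : A → Z} (hf : Measurable f) {g : B → W} (hg : Measurable g) :
    Couplings (μ.map f) (ν.map g) = Measure.map (Prod.map f g) '' Couplings μ ν := by
  ext γ
  constructor
  · intro hγ
    obtain ⟨σ, hσ, rfl⟩ := exists_coupling_map_left hf hγ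
    obtain ⟨τ, hτ, hτσ⟩ := exists_coupling_map_left hg (map_swap_mem_couplings hσ)
    refine ⟨τ.map Prod.swap, map_swap_mem_couplings hτ, ?_⟩
    have h : σ = (τ.map (Prod.map g id)).map Prod.swap := by
      rw [hτσ, Measure.map_map measurable_swap measurable_swap]
      simp
    rw [h, Measure.map_map measurable_swap (by fun_prop),
      Measure.map_map (by fun_prop) (by fun_prop), Measure.map_map (by fun_prop) (by fun_prop)]
    rfl
  · rintro ⟨σ, ⟨h, h₁, h₂⟩, rfl⟩
    refine ⟨Measure.isProbabilityMeasure_map (by fun_prop), ?_, ?_⟩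
    · rw [← h₁, Measure.map_map (by fun_prop) (by fun_prop),
        Measure.map_map (by fun_prop) (by fun_prop)]
      rfl
    · rw [← h₂, Measure.map_map (by fun_prop) (by fun_prop),
        Measure.map_map (by fun_prop) (by fun_prop)]
      rfl

theorem prod_mem_couplings {A B : Type*} [MeasurableSpace A] [MeasurableSpace B]
    (μ : Measure A) [IsProbabilityMeasure μ] (ν : Measure B) [IsProbabilityMeasure ν] :
    μ.prod ν ∈ Couplings μ ν :=
  ⟨inferInstance, by simp, by simp⟩

/-- The tensor square of a coupling is a coupling of the tensor squares. -/
theorem map_prod_self_mem_couplings {A B : Type*} [MeasurableSpace A] [MeasurableSpace B]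
    {μ : Measure A} {ν : Measure B} {π : Measure (A × B)} (hπ : π ∈ Couplings μ ν) :
    (π.prod π).map (fun w => ((w.1.1, w.2.1), (w.1.2, w.2.2))) ∈
      Couplings (μ.prod μ) (ν.prod ν) := by
  obtain ⟨h, rfl, rfl⟩ := hπ
  refine ⟨Measure.isProbabilityMeasure_map (by fun_prop), ?_, ?_⟩
  · rw [Measure.map_map (by fun_prop) (by fun_prop),
      Measure.map_prod_map _ _ measurable_fst measurable_fst]
    rfl
  · rw [Measure.map_map (by fun_prop) (by fun_prop),
      Measure.map_prod_map _ _ measurable_snd measurable_snd]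
    rfl

theorem IsNetwork.exists_memLp_dist {X Z : Type*} [MeasurableSpace X] [MeasurableSpace Z]
    [PseudoMetricSpace Z] [OpensMeasurableSpace Z] {p : ℝ} (hp : 0 < p)
    {ω : X × X → Z} {μ : Measure X} (h : IsNetwork p ω μ) :
    ∃ z₀ : Z, MemLp (fun q => dist (ω q) z₀) (ENNReal.ofReal p) (μ.prod μ) := by
  obtain ⟨hμ, hω, z₀, hz⟩ := h
  have hm : Measurable (fun q => dist (ω q) z₀) :=
    (continuous_id.dist continuous_const).measurable.comp hω
  refine ⟨z₀, ?_⟩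
  rw [← integrable_norm_rpow_iff hm.aestronglyMeasurable
    (by simpa using hp) ENNReal.ofReal_ne_top, ENNReal.toReal_ofReal hp.le]
  simp only [Real.norm_eq_abs, abs_of_nonneg dist_nonneg]
  refine ⟨(hm.pow_const p).aestronglyMeasurable, ?_⟩
  rw [hasFiniteIntegral_iff_ofReal (ae_of_all _ fun _ => by positivity),
    lintegral_prod _ (by fun_prop)]
  exact hz

/-- The `p`-th power of the distance between two network kernels is integrable against any
coupling of the tensor squares. -/
theorem integrable_dist_rpow_of_mem_couplings {X Y Z : Type*} [MeasurableSpace X]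
    [MeasurableSpace Y] [MeasurableSpace Z] [PseudoMetricSpace Z] [OpensMeasurableSpace Z]
    [SecondCountableTopology Z] {p : ℝ} (hp : 1 ≤ p)
    {ωX : X × X → Z} {μX : Measure X} (hX : IsNetwork p ωX μX)
    {ωY : Y × Y → Z} {μY : Measure Y} (hY : IsNetwork p ωY μY)
    {σ : Measure ((X × X) × (Y × Y))} (hσ : σ ∈ Couplings (μX.prod μX) (μY.prod μY)) :
    Integrable (fun q => dist (ωX q.1) (ωY q.2) ^ p) σ := by
  have hp₀ : 0 < p := by linarith
  obtain ⟨x₀, hx⟩ := hX.exists_memLp_dist hp₀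
  obtain ⟨y₀, hy⟩ := hY.exists_memLp_dist hp₀
  obtain ⟨h, h₁, h₂⟩ := hσ
  have hωX := hX.meas
  have hωY := hY.meas
  rw [← h₁] at hx
  rw [← h₂] at hy
  have hx' := hx.comp_of_map measurable_fst.aemeasurable
  have hy' := hy.comp_of_map measurable_snd.aemeasurable
  have hm : Measurable (fun q : (X × X) × (Y × Y) => dist (ωX q.1) (ωY q.2)) := by fun_prop
  have hL : MemLp (fun q : (X × X) × (Y × Y) => dist (ωX q.1) (ωY q.2)) (ENNReal.ofReal p) σ := by
    refine ((hx'.add (memLp_const (dist x₀ y₀))).add hy').mono hm.aestronglyMeasurable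
      (ae_of_all _ fun q => ?_)
    simp only [Pi.add_apply, Function.comp_apply, Real.norm_eq_abs, abs_of_nonneg dist_nonneg]
    refine le_trans ?_ (le_abs_self _)
    have h3 := dist_triangle4 (ωX q.1) x₀ y₀ (ωY q.2)
    rwa [dist_comm y₀] at h3
  have hI := hL.integrable_norm_rpow (by simpa using hp₀) ENNReal.ofReal_ne_top
  simpa [ENNReal.toReal_ofReal hp₀.le] using hI

/-- **Second lower bound (SLB)**: the `Z`-Gromov–Wasserstein distance is bounded below
by half the infimum over couplings `σ` of `μ_X ⊗ μ_X` and `μ_Y ⊗ μ_Y` of the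
`L^p(σ)`-norm of `d_Z(ω_X, ω_Y)`, and this lower bound equals half the Wasserstein
distance between the pushforward distributions of the kernels. -/
theorem gw_second_lower_bound
    {X Y Z : Type*}
    [MeasurableSpace X] [TopologicalSpace X] [PolishSpace X] [BorelSpace X]
    [MeasurableSpace Y] [TopologicalSpace Y] [PolishSpace Y] [BorelSpace Y]
    [MetricSpace Z] [MeasurableSpace Z] [BorelSpace Z] [TopologicalSpace.SeparableSpace Z]
    (p : ℝ) (hp : 1 ≤ p)
    (ωX : X × X → Z) (μX : Measure X) (hX : IsNetwork p ωX μX)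
    [IsProbabilityMeasure μX]
    (ωY : Y × Y → Z) (μY : Measure Y) (hY : IsNetwork p ωY μY)
    [IsProbabilityMeasure μY] :
    GW p ωX μX ωY μY ≥
      (1 / 2) * sInf ((fun σ : Measure ((X × X) × (Y × Y)) =>
        (∫ q, dist (ωX q.1) (ωY q.2) ^ p ∂σ) ^ (1 / p)) ''
          Couplings (μX.prod μX) (μY.prod μY)) ∧
    (1 / 2) * sInf ((fun σ : Measure ((X × X) × (Y × Y)) =>
        (∫ q, dist (ωX q.1) (ωY q.2) ^ p ∂σ) ^ (1 / p)) ''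
          Couplings (μX.prod μX) (μY.prod μY)) =
      (1 / 2) * Wp p ((μX.prod μX).map ωX) ((μY.prod μY).map ωY) := by
  have hp₀ : 0 < p := by linarith
  have : SecondCountableTopology Z := UniformSpace.secondCountable_of_separable Z
  have hωX := hX.meas
  have hωY := hY.meas
  have hm : Measurable (fun q : Z × Z => dist q.1 q.2 ^ p) := by fun_prop
  constructor
  · refine mul_le_mul_of_nonneg_left ?_ (by norm_num)
    refine le_csInf ⟨_, _, prod_mem_couplings μX μY, rfl⟩ ?_
    rintro _ ⟨π, hπ, rfl⟩
    have hσ := map_prod_self_mem_couplings hπ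
    have hI := integrable_dist_rpow_of_mem_couplings hp hX hY hσ
    refine csInf_le ⟨0, ?_⟩ ⟨_, hσ, ?_⟩
    · rintro _ ⟨σ, -, rfl⟩
      positivity
    · have := hπ.1
      have hI' := hI.comp_measurable (by fun_prop)
      simp only [dis]
      rw [integral_map (by fun_prop) hI.aestronglyMeasurable]
      exact congrArg (· ^ (1 / p)) (integral_prod _ hI')
  · rw [Wp, couplings_map _ _ hωX hωY, Set.image_image]
    congr 3 with σ
    rw [integral_map (by fun_prop) hm.aestronglyMeasurable]
    rfl
end
end
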